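/- arXiv:1109.1913 — 2 statements merged into one kernel-verified Lean document; each statement's English description precedes it below -/
import Mathlib

section
/- Let r > 0 and Δ ≥ 0 be reals, and let s and t be positive integers with s ≤ diag(B_r((0,0))). Assume: (a) S_{r,Δ}((0,0),(−1,0)) intersects all diagonal lines modulo s; (b) S_{r,Δ}((0,0),(−1,−1)) intersects all horizontal lines modulo t; (c) √(⌊r⌋² + 4) ≤ r < ⌊r⌋ + 1. Then the code C = L^d_s ∪ L^h_t is an (r,Δ)-identifying code, and D(C) = 1/s + 1/t − 1/(st). -/
open Filter

def ball (r : ℝ) (u : ℤ × ℤ) : Set (ℤ × ℤ) :=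
  {v : ℤ × ℤ | ((v.1 - u.1 : ℤ) : ℝ) ^ 2 + ((v.2 - u.2 : ℤ) : ℝ) ^ 2 ≤ r ^ 2}

def Spat (r Δ : ℝ) (u v : ℤ × ℤ) : Set (ℤ × ℤ) :=
  (ball r u \ ball (r + Δ) v) ∪ (ball r v \ ball (r + Δ) u)

def IsIdCode (r Δ : ℝ) (C : Set (ℤ × ℤ)) : Prop :=
  (∀ u : ℤ × ℤ, (ball r u ∩ C).Nonempty) ∧
    ∀ u v : ℤ × ℤ, u ≠ v → (Spat r Δ u v ∩ C).Nonempty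

def Qset (n : ℕ) : Set (ℤ × ℤ) := {p : ℤ × ℤ | |p.1| ≤ (n : ℤ) ∧ |p.2| ≤ (n : ℤ)}

noncomputable def density (C : Set (ℤ × ℤ)) : ℝ :=
  Filter.limsup
    (fun n : ℕ => (Nat.card ↥(C ∩ Qset n) : ℝ) / ((2 * (n : ℝ) + 1) ^ 2))
    Filter.atTop

def IntersectsDiagMod (U : Set (ℤ × ℤ)) (k : ℕ) : Prop :=
  ∀ i : ℤ, ∃ p ∈ U, Int.ModEq (k : ℤ) (p.2 - p.1) i

def IntersectsAntiDiagMod (U : Set (ℤ × ℤ)) (k : ℕ) : Prop :=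
  ∀ i : ℤ, ∃ p ∈ U, Int.ModEq (k : ℤ) (p.1 + p.2) i

def IntersectsHorizMod (U : Set (ℤ × ℤ)) (k : ℕ) : Prop :=
  ∀ i : ℤ, ∃ p ∈ U, Int.ModEq (k : ℤ) p.2 i

noncomputable def diagNum (U : Set (ℤ × ℤ)) : ℕ :=
  sSup {k : ℕ | 0 < k ∧ IntersectsDiagMod U k}

def Lv (k : ℕ) : Set (ℤ × ℤ) := {p : ℤ × ℤ | (k : ℤ) ∣ p.1}
def Lh (k : ℕ) : Set (ℤ × ℤ) := {p : ℤ × ℤ | (k : ℤ) ∣ p.2}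
def Ld (k : ℕ) : Set (ℤ × ℤ) := {p : ℤ × ℤ | (k : ℤ) ∣ (p.2 - p.1)}

/-- The separating set of the origin and `(a, b)`, for the integer squared radii `N` (inner)
and `M` (outer), as a predicate on the point `(x, y)`. -/
def Separates (N M a b x y : ℤ) : Prop :=
  (x ^ 2 + y ^ 2 ≤ N ∧ M < (x - a) ^ 2 + (y - b) ^ 2) ∨
    ((x - a) ^ 2 + (y - b) ^ 2 ≤ N ∧ M < x ^ 2 + y ^ 2)

theorem mem_ball_iff_floor (r : ℝ) (u v : ℤ × ℤ) :
    v ∈ ball r u ↔ (v.1 - u.1) ^ 2 + (v.2 - u.2) ^ 2 ≤ ⌊r ^ 2⌋ := by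
  rw [Int.le_floor]
  simp [ball]

theorem mem_Spat_iff_separates (r Δ : ℝ) (u v q : ℤ × ℤ) :
    q ∈ Spat r Δ u v ↔ Separates ⌊r ^ 2⌋ ⌊(r + Δ) ^ 2⌋ (v.1 - u.1) (v.2 - u.2)
      (q.1 - u.1) (q.2 - u.2) := by
  have h1 : q.1 - u.1 - (v.1 - u.1) = q.1 - v.1 := by ring
  have h2 : q.2 - u.2 - (v.2 - u.2) = q.2 - v.2 := by ring
  simp only [Spat, Set.mem_union, Set.mem_sdiff, mem_ball_iff_floor, Separates, not_le, h1, h2]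

theorem Spat_comm (r Δ : ℝ) (u v : ℤ × ℤ) : Spat r Δ u v = Spat r Δ v u :=
  Set.union_comm _ _

theorem Separates.swap {N M a b x y : ℤ} (h : Separates N M a b x y) :
    Separates N M b a y x := by
  simpa [Separates, add_comm] using h

/-- The points whose diagonal offset is `δ` meet a centred disc as soon as
some diagonal at least as far from the centre does. -/
theorem exists_mem_disc_of_abs_le {N x y δ : ℤ} (h : x ^ 2 + y ^ 2 ≤ N) (hδ : |δ| ≤ |y - x|) :
    ∃ x' y' : ℤ, x' ^ 2 + y' ^ 2 ≤ N ∧ y' - x' = δ := by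
  have hsq : δ ^ 2 ≤ (y - x) ^ 2 := sq_le_sq.mpr hδ
  rcases Int.even_or_odd' δ with ⟨k, rfl | rfl⟩
  · refine ⟨-k, k, ?_, by ring⟩
    nlinarith [sq_nonneg (x + y)]
  · refine ⟨-k, k + 1, ?_, by ring⟩
    have hxy : x + y ≠ 0 ∨ (2 * k + 1) ^ 2 < (y - x) ^ 2 := by
      by_contra! hcon
      obtain ⟨h0, h1⟩ := hcon
      have h2 : (2 * k + 1) ^ 2 = (2 * x) ^ 2 := by
        have : y = -x := by lia
        subst this
        nlinarith
      rcases sq_eq_sq_iff_eq_or_eq_neg.mp h2 with h3 | h3 <;> lia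
    rcases hxy with h0 | h1
    · have : 1 ≤ (x + y) ^ 2 := by
        have := sq_pos_of_ne_zero h0
        lia
      nlinarith
    · nlinarith [sq_nonneg (x + y)]

/-- The last point of a centred disc on a diagonal, going up and to the right. -/
theorem exists_last_mem_disc {N x y : ℤ} (h : x ^ 2 + y ^ 2 ≤ N) :
    ∃ x' y' : ℤ, x' ^ 2 + y' ^ 2 ≤ N ∧ y' - x' = y - x ∧ N < (x' + 1) ^ 2 + (y' + 1) ^ 2 := by
  classical
  have hex : ∃ k : ℕ, N < (x + k + 1) ^ 2 + (y + k + 1) ^ 2 := by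
    refine ⟨(|x| + N).toNat, ?_⟩
    have hN : 0 ≤ N := by nlinarith [sq_nonneg x, sq_nonneg y]
    have hk : (((|x| + N).toNat : ℕ) : ℤ) = |x| + N := Int.toNat_of_nonneg (by positivity)
    rw [hk]
    have : N + 1 ≤ x + (|x| + N) + 1 := by linarith [neg_abs_le x]
    nlinarith [sq_nonneg (y + (|x| + N) + 1)]
  refine ⟨x + Nat.find hex, y + Nat.find hex, ?_, by ring, Nat.find_spec hex⟩
  rcases Nat.eq_zero_or_pos (Nat.find hex) with h0 | h0
  · simpa [h0] using h
  · have := Nat.find_min hex (Nat.sub_lt h0 one_pos)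
    push Not at this
    have hc : ((Nat.find hex - 1 : ℕ) : ℤ) = (Nat.find hex : ℤ) - 1 := by lia
    rw [hc] at this
    linarith

theorem exists_last_mem_row {N x y : ℤ} (h : x ^ 2 + y ^ 2 ≤ N) :
    ∃ x' : ℤ, x ≤ x' ∧ x' ^ 2 + y ^ 2 ≤ N ∧ N < (x' + 1) ^ 2 + y ^ 2 := by
  obtain ⟨x', hx', hmax⟩ := Int.exists_greatest_of_bdd (P := fun z => x ≤ z ∧ z ^ 2 + y ^ 2 ≤ N)
    ⟨N + 1, fun z hz => by nlinarith [hz.2, sq_nonneg y, sq_nonneg (z - 1)]⟩ ⟨x, le_rfl, h⟩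
  refine ⟨x', hx'.1, hx'.2, ?_⟩
  by_contra! hcon
  have := hmax (x' + 1) ⟨by lia, hcon⟩
  lia

/-- The quadratic estimate behind `exists_separates_diag_of_steep`; here `σ` and `d` are the
sum and difference of the coordinates of the last point of the disc on a diagonal. -/
theorem two_mul_le_of_steep {b c d σ m : ℤ} (hb : 6 ≤ b) (hc : 4 * c ≤ b) (hc' : -(4 * c) ≤ b)
    (hσ : 0 ≤ σ) (hd : c - b ≤ 2 * d) (hm : 2 * m ^ 2 + 10 ≤ (σ + 2) ^ 2 + d ^ 2) :
    2 * m ≤ (b + c - 2) * σ + (b - c) * d + b ^ 2 + c ^ 2 - 2 := by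
  have he : 5 ≤ b + c := by lia
  have hk : 5 ≤ b - c := by lia
  have h3 : 3 * σ ≤ (b + c - 2) * σ := by nlinarith
  have hT : ∀ T : ℤ, 0 ≤ T → 2 * m ^ 2 + 10 ≤ T ^ 2 → 2 * m + 8 ≤ 3 * T := by
    intro T hT0 hT
    by_contra! hlt
    nlinarith [sq_nonneg (7 * m - 8)]
  rcases le_or_gt 0 d with h0 | h0
  · have := hT (σ + 2 + d) (by lia) (by nlinarith)
    nlinarith
  · have := hT (σ + 2 - d) (by lia) (by nlinarith)
    have h5 : (b - c) * (-(2 * d)) ≤ (b - c) ^ 2 := by nlinarith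
    have h6 : 6 * (-d) ≤ (b + c) ^ 2 := by nlinarith
    nlinarith

/-- If `(-c, -b)` is far from the origin and steep, then every diagonal meeting the disc
around the origin meets the separating set. -/
theorem exists_separates_diag_of_steep {N M m b c x y : ℤ} (hm : m ^ 2 + 4 ≤ N)
    (hM : M ≤ N + 2 * m) (hb : 6 ≤ b) (hc : 4 * c ≤ b) (hc' : -(4 * c) ≤ b)
    (h : x ^ 2 + y ^ 2 ≤ N) :
    ∃ x' y' : ℤ, Separates N M (-c) (-b) x' y' ∧ y' - x' = y - x := by
  have key : ∀ x y : ℤ, x ^ 2 + y ^ 2 ≤ N → c - b ≤ 2 * (y - x) →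
      ∃ x' y' : ℤ, x' ^ 2 + y' ^ 2 ≤ N ∧ M < (x' + c) ^ 2 + (y' + b) ^ 2 ∧ y' - x' = y - x := by
    intro x y h hd
    obtain ⟨x', y', h1, h2, h3⟩ := exists_last_mem_disc h
    refine ⟨x', y', h1, ?_, h2⟩
    rw [← h2] at hd
    have := two_mul_le_of_steep (m := m) (σ := x' + y') hb hc hc' (by nlinarith) hd (by nlinarith)
    nlinarith
  rcases le_or_gt (c - b) (2 * (y - x)) with hd | hd
  · obtain ⟨x', y', h1, h2, h3⟩ := key x y h hd
    exact ⟨x', y', Or.inl ⟨h1, by simpa using h2⟩, h3⟩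
  · obtain ⟨x₁, y₁, h1, h2⟩ := exists_mem_disc_of_abs_le (δ := c - b - (y - x)) h (by
      rw [abs_le, abs_of_neg (by lia : y - x < 0)]
      lia)
    obtain ⟨x', y', h3, h4, h5⟩ := key x₁ y₁ h1 (by lia)
    refine ⟨-c - x', -b - y', Or.inr ⟨?_, ?_⟩, by lia⟩
    · convert h3 using 1
      ring
    · convert h4 using 1
      ring

/-- If `(-c, -b)` is at vertical distance at least `2 m + 2`, the two discs are disjoint. -/
theorem separates_of_disjoint {N M m b c x y : ℤ} (hm0 : 0 ≤ m) (hm' : N < (m + 1) ^ 2)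
    (hM : M ≤ N + 2 * m) (hb : 2 * m + 2 ≤ b) (h : x ^ 2 + y ^ 2 ≤ N) :
    Separates N M (-c) (-b) x y := by
  refine Or.inl ⟨h, ?_⟩
  have hy : -m ≤ y := by nlinarith [sq_nonneg x]
  have : m + 2 ≤ y - -b := by lia
  nlinarith [sq_nonneg (x - -c)]

/-- The separating set of `(0, 0)` and `(-a, -b)` meets row `y` whenever that of `(0, 0)` and
`(-1, -1)` meets it inside the disc around the origin. -/
theorem exists_separates_row {N M a b x y : ℤ} (hNM : N ≤ M) (ha : 1 ≤ a) (hb : 1 ≤ b)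
    (h : x ^ 2 + y ^ 2 ≤ N) (h' : M < (x + 1) ^ 2 + (y + 1) ^ 2) (hx : 0 ≤ x) :
    ∃ x' : ℤ, Separates N M (-a) (-b) x' y := by
  have hxy : 0 ≤ x + y := by nlinarith
  have hxa : (x + 1) ^ 2 ≤ (x + a) ^ 2 := by nlinarith
  rcases le_or_gt (|y + 1|) |y + b| with hyb | hyb
  · have := sq_le_sq.mpr hyb
    exact ⟨x, Or.inl ⟨h, by simp only [sub_neg_eq_add]; lia⟩⟩
  · have hy : y ≤ -1 ∧ b ≤ 2 * -y := by
      rw [abs_lt] at hyb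
      rcases abs_cases (y + 1) with ⟨h1, h2⟩ | ⟨h1, h2⟩ <;> lia
    refine ⟨-a - x, Or.inr ⟨?_, ?_⟩⟩
    · have : (y - -b) ^ 2 ≤ y ^ 2 := by nlinarith
      have e : (-a - x - -a) ^ 2 = x ^ 2 := by ring
      lia
    · have e : (-a - x) ^ 2 = (x + a) ^ 2 := by ring
      have : (y + 1) ^ 2 ≤ y ^ 2 := by nlinarith
      lia

/-- If the boundary of a disc recedes by at least `a` from row `y` to row `y + 1`, then every
`b > 2 y + 1` is large, also in comparison with `a`. -/
theorem steep_of_row_drop {N m a b x y z : ℤ} (hm' : N < (m + 1) ^ 2) (ha : 1 ≤ a)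
    (h : x ^ 2 + y ^ 2 ≤ N) (hz : N < (z + 1) ^ 2 + (y + 1) ^ 2) (hz2 : 2 ≤ z)
    (hby : 2 * y + 1 < b) (hza : z + a < x + 1) (hm : m ^ 2 + 4 ≤ N) (hy : -1 < y) :
    6 ≤ b ∧ 4 * a ≤ b := by
  have hxm : x ≤ m := by nlinarith [sq_nonneg y]
  have h1 : (z + 1) ^ 2 ≤ (x - a + 1) ^ 2 := pow_le_pow_left₀ (by lia) (by lia) 2
  have h0 : (x - a + 1) ^ 2 ≤ x ^ 2 := pow_le_pow_left₀ (by lia) (by lia) 2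
  have hx2 : x ^ 2 ≤ m ^ 2 := pow_le_pow_left₀ (by lia) hxm 2
  have hy2 : 2 ≤ y := by
    by_contra! hlt
    have : (y + 1) ^ 2 ≤ 2 ^ 2 := pow_le_pow_left₀ (by lia) (by lia) 2
    linarith
  have h2 : (a - 1) * (2 * x - a + 1) < 2 * y + 1 := by linarith
  have h3 : (a - 1) * (a + 5) ≤ (a - 1) * (2 * x - a + 1) := by
    apply mul_le_mul_of_nonneg_left <;> lia
  constructor
  · lia
  · rcases eq_or_lt_of_le ha with h4 | h4
    · lia
    · nlinarith only [h2, h3, hby, h4]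

/-- The reflected counterpart of `exists_separates_row`, with an exception when `(-a, -b)` is
far and steep. -/
theorem exists_separates_reflected_row {N M m a b x y : ℤ}
    (hm : m ^ 2 + 4 ≤ N) (hm' : N < (m + 1) ^ 2) (ha : 1 ≤ a) (hb : 1 ≤ b)
    (h : x ^ 2 + y ^ 2 ≤ N) (h' : M < (x + 1) ^ 2 + (y + 1) ^ 2) (hx : 0 ≤ x)
    (hfar : b < 2 * m + 2) (hsteep : ¬ (6 ≤ b ∧ 4 * a ≤ b)) :
    ∃ x' : ℤ, Separates N M (-a) (-b) x' (-1 - y) := by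
  have hxa : (x + 1) ^ 2 ≤ (x + a) ^ 2 := pow_le_pow_left₀ (by lia) (by lia) 2
  have e : (-1 - y) ^ 2 = (y + 1) ^ 2 := by ring
  rcases le_or_gt y (-1) with hy | hy
  · have h1 : (-1 - y) ^ 2 ≤ (-y) ^ 2 := pow_le_pow_left₀ (by lia) (by lia) 2
    have h2 : (-1 - y) ^ 2 ≤ (-1 - y + b) ^ 2 := pow_le_pow_left₀ (by lia) (by lia) 2
    refine ⟨x, Or.inl ⟨?_, ?_⟩⟩
    · linarith
    · simp only [sub_neg_eq_add]
      linarith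
  rcases le_or_gt b (2 * y + 1) with hby | hby
  · have h1 : (-1 - y - -b) ^ 2 ≤ y ^ 2 := sq_le_sq' (by lia) (by lia)
    exact ⟨-a - x, Or.inr ⟨by linarith, by linarith⟩⟩
  have hym : y + 1 ≤ m := by lia
  have hym2 : (y + 1) ^ 2 ≤ m ^ 2 := pow_le_pow_left₀ (by lia) hym 2
  obtain ⟨z, hz2, hz, hz'⟩ := exists_last_mem_row (N := N) (x := 2) (y := y + 1) (by linarith)
  rcases le_or_gt (x + 1) (z + a) with hza | hza
  · have h1 : (x + 1) ^ 2 ≤ (z + a) ^ 2 := pow_le_pow_left₀ (by lia) hza 2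
    have h2 : (y + 1) ^ 2 ≤ (-1 - y + b) ^ 2 := pow_le_pow_left₀ (by lia) (by lia) 2
    refine ⟨z, Or.inl ⟨by linarith, ?_⟩⟩
    simp only [sub_neg_eq_add]
    linarith
  exact (hsteep (steep_of_row_drop hm' ha h hz' hz2 hby hza hm hy)).elim

/-- The horizontal shift `(-1, 0)` separates no more than the shifts `(-a, 0)` with `a ≤ 5`. -/
theorem Separates.of_shift_one {N M m a x y : ℤ} (hNM : N ≤ M) (hm0 : 0 ≤ m)
    (hm : m ^ 2 + 4 ≤ N) (hm' : N < (m + 1) ^ 2) (ha : 1 ≤ a) (ha' : a ≤ 5)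
    (h : Separates N M (-1) 0 x y) : Separates N M (-a) 0 x y := by
  rcases h with ⟨h1, h2⟩ | ⟨h1, h2⟩
  · refine Or.inl ⟨h1, ?_⟩
    nlinarith
  · refine Or.inr ⟨?_, h2⟩
    have hy : y ^ 2 ≤ m ^ 2 := by
      have hy1 : y ≤ m := by nlinarith [sq_nonneg (x - -1)]
      have hy2 : -m ≤ y := by nlinarith [sq_nonneg (x - -1)]
      nlinarith
    have hx : x ≤ 0 := by nlinarith
    have hx3 : x ≤ -3 := by nlinarith
    nlinarith

theorem abs_le_abs_of_modEq {j v : ℤ} {s k : ℕ} (hsk : s ≤ k) (hj : 2 * |j| ≤ s)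
    (h : v ≡ j [ZMOD k]) : |j| ≤ |v| := by
  obtain ⟨z, hz⟩ := h.symm.dvd
  rcases lt_trichotomy z 0 with hz0 | rfl | hz0
  · have : (k : ℤ) * z ≤ -k := by nlinarith
    grind
  · simp_all [sub_eq_zero]
  · have : (k : ℤ) ≤ (k : ℤ) * z := by nlinarith
    grind

/-- A disc meets all diagonals modulo every `s` up to its diagonal number. -/
theorem exists_mem_disc_modEq {r : ℝ} {s : ℕ} (hs : 0 < s)
    (hsd : s ≤ diagNum (ball r ((0, 0) : ℤ × ℤ))) (i : ℤ) :
    ∃ x y : ℤ, x ^ 2 + y ^ 2 ≤ ⌊r ^ 2⌋ ∧ y - x ≡ i [ZMOD s] := by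
  unfold diagNum at hsd
  set K := {k : ℕ | 0 < k ∧ IntersectsDiagMod (ball r ((0, 0) : ℤ × ℤ)) k} with hK
  have hbdd : BddAbove K := by
    by_contra hcon
    rw [Nat.sSup_of_not_bddAbove hcon] at hsd
    lia
  have hne : K.Nonempty := by
    by_contra hcon
    rw [Set.not_nonempty_iff_eq_empty.mp hcon] at hsd
    simp at hsd
    lia
  obtain ⟨-, hk⟩ := Nat.sSup_mem hne hbdd
  obtain ⟨p, hp, hpm⟩ := hk (Int.bmod i s)
  have h2 : 2 * |Int.bmod i s| ≤ s := by
    have h1 := Int.bmod_le (x := i) hs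
    have h2 := Int.le_bmod (x := i) hs
    rcases abs_cases (Int.bmod i s) with ⟨h, -⟩ | ⟨h, -⟩ <;> lia
  rw [mem_ball_iff_floor] at hp
  simp only [sub_zero] at hp
  obtain ⟨x, y, hxy, hd⟩ := exists_mem_disc_of_abs_le hp (abs_le_abs_of_modEq hsd h2 hpm)
  refine ⟨x, y, hxy, ?_⟩
  rw [hd]
  exact Int.bmod_emod

/-- The separating set of the origin and `(a, b)` meets all diagonals modulo `s` or all rows
modulo `t`. -/
def HitsLines (N M : ℤ) (s t : ℕ) (a b : ℤ) : Prop :=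
  (∀ i : ℤ, ∃ x y : ℤ, Separates N M a b x y ∧ y - x ≡ i [ZMOD s]) ∨
    (∀ i : ℤ, ∃ x y : ℤ, Separates N M a b x y ∧ y ≡ i [ZMOD t])

theorem HitsLines.nonempty {r Δ : ℝ} {s t : ℕ} {u v : ℤ × ℤ}
    (h : HitsLines ⌊r ^ 2⌋ ⌊(r + Δ) ^ 2⌋ s t (v.1 - u.1) (v.2 - u.2)) :
    (Spat r Δ u v ∩ (Ld s ∪ Lh t)).Nonempty := by
  rcases h with h | h
  · obtain ⟨x, y, hxy, hd⟩ := h (-(u.2 - u.1))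
    refine ⟨(u.1 + x, u.2 + y), ?_, Or.inl ?_⟩
    · rw [mem_Spat_iff_separates]
      simpa using hxy
    · have := hd.symm.dvd
      simp only [Ld, Set.mem_ofPred_eq]
      convert this using 1
      ring
  · obtain ⟨x, y, hxy, hd⟩ := h (-u.2)
    refine ⟨(u.1 + x, u.2 + y), ?_, Or.inr ?_⟩
    · rw [mem_Spat_iff_separates]
      simpa using hxy
    · have := hd.symm.dvd
      simp only [Lh, Set.mem_ofPred_eq]
      convert this using 1
      ring

section Hits

variable {N M m : ℤ} {s t : ℕ}

theorem hitsLines_of_steep (hm : m ^ 2 + 4 ≤ N) (hM : M ≤ N + 2 * m)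
    (hdisc : ∀ i : ℤ, ∃ x y : ℤ, x ^ 2 + y ^ 2 ≤ N ∧ y - x ≡ i [ZMOD s])
    {b c : ℤ} (hb : 6 ≤ b) (hc : 4 * c ≤ b) (hc' : -(4 * c) ≤ b) :
    ∀ i : ℤ, ∃ x y : ℤ, Separates N M (-c) (-b) x y ∧ y - x ≡ i [ZMOD s] := by
  intro i
  obtain ⟨x, y, hxy, hi⟩ := hdisc i
  obtain ⟨x', y', h1, h2⟩ := exists_separates_diag_of_steep hm hM hb hc hc' hxy
  exact ⟨x', y', h1, h2 ▸ hi⟩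

theorem hitsLines_horizontal (hNM : N ≤ M) (hm0 : 0 ≤ m) (hm : m ^ 2 + 4 ≤ N)
    (hm' : N < (m + 1) ^ 2) (hM : M ≤ N + 2 * m)
    (hdisc : ∀ i : ℤ, ∃ x y : ℤ, x ^ 2 + y ^ 2 ≤ N ∧ y - x ≡ i [ZMOD s])
    (ha : ∀ i : ℤ, ∃ x y : ℤ, Separates N M (-1) 0 x y ∧ y - x ≡ i [ZMOD s])
    {a : ℤ} (ha1 : 1 ≤ a) (i : ℤ) :
    ∃ x y : ℤ, Separates N M (-a) 0 x y ∧ y - x ≡ i [ZMOD s] := by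
  rcases le_or_gt a 5 with ha5 | ha5
  · obtain ⟨x, y, hxy, hi⟩ := ha i
    exact ⟨x, y, hxy.of_shift_one hNM hm0 hm hm' ha1 ha5, hi⟩
  · obtain ⟨x, y, hxy, hi⟩ := hitsLines_of_steep (c := 0) hm hM hdisc
      (by lia : 6 ≤ a) (by lia) (by lia) (-i)
    refine ⟨y, x, by simpa using hxy.swap, ?_⟩
    simpa using hi.neg

theorem hitsLines_vertical (hNM : N ≤ M) (hm0 : 0 ≤ m) (hm : m ^ 2 + 4 ≤ N)
    (hm' : N < (m + 1) ^ 2) (hM : M ≤ N + 2 * m)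
    (hdisc : ∀ i : ℤ, ∃ x y : ℤ, x ^ 2 + y ^ 2 ≤ N ∧ y - x ≡ i [ZMOD s])
    (ha : ∀ i : ℤ, ∃ x y : ℤ, Separates N M (-1) 0 x y ∧ y - x ≡ i [ZMOD s])
    {b : ℤ} (hb1 : 1 ≤ b) (i : ℤ) :
    ∃ x y : ℤ, Separates N M 0 (-b) x y ∧ y - x ≡ i [ZMOD s] := by
  obtain ⟨x, y, hxy, hi⟩ := hitsLines_horizontal hNM hm0 hm hm' hM hdisc ha hb1 (-i)
  exact ⟨y, x, hxy.swap, by simpa using hi.neg⟩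

theorem exists_separates_row_modEq (hNM : N ≤ M) (hm : m ^ 2 + 4 ≤ N)
    (hm' : N < (m + 1) ^ 2)
    (hb : ∀ i : ℤ, ∃ x y : ℤ, Separates N M (-1) (-1) x y ∧ y ≡ i [ZMOD t])
    {a b : ℤ} (ha1 : 1 ≤ a) (hb1 : 1 ≤ b) (hfar : b < 2 * m + 2)
    (hsteep : ¬ (6 ≤ b ∧ 4 * a ≤ b)) (i : ℤ) :
    ∃ x y : ℤ, Separates N M (-a) (-b) x y ∧ y ≡ i [ZMOD t] := by
  have habs : ∀ x : ℤ, (x + 1) ^ 2 ≤ (|x| + 1) ^ 2 := fun x => by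
    nlinarith [sq_abs x, le_abs_self x]
  obtain ⟨x, y, h | h, hi⟩ := hb i
  · obtain ⟨h1, h2⟩ := h
    simp only [sub_neg_eq_add] at h2
    obtain ⟨x', hx'⟩ := exists_separates_row (x := |x|) (y := y) hNM ha1 hb1
      (by rwa [sq_abs]) (by linarith [habs x]) (abs_nonneg x)
    exact ⟨x', y, hx', hi⟩
  · obtain ⟨h1, h2⟩ := h
    simp only [sub_neg_eq_add] at h1
    obtain ⟨x', hx'⟩ := exists_separates_reflected_row (M := M) (x := |-1 - x|) (y := -1 - y) hm hm'
      ha1 hb1 (by rw [sq_abs]; linarith) (by linarith [habs (-1 - x)]) (abs_nonneg _) hfar hsteep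
    exact ⟨x', y, by simpa using hx', hi⟩

theorem hitsLines_neg (hNM : N ≤ M) (hm0 : 0 ≤ m) (hm : m ^ 2 + 4 ≤ N)
    (hm' : N < (m + 1) ^ 2) (hM : M ≤ N + 2 * m)
    (hdisc : ∀ i : ℤ, ∃ x y : ℤ, x ^ 2 + y ^ 2 ≤ N ∧ y - x ≡ i [ZMOD s])
    (ha : ∀ i : ℤ, ∃ x y : ℤ, Separates N M (-1) 0 x y ∧ y - x ≡ i [ZMOD s])
    (hb : ∀ i : ℤ, ∃ x y : ℤ, Separates N M (-1) (-1) x y ∧ y ≡ i [ZMOD t])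
    {c b : ℤ} (hb1 : 1 ≤ b) : HitsLines N M s t (-c) (-b) := by
  rcases eq_or_ne c 0 with rfl | hc0
  · left
    simpa using hitsLines_vertical hNM hm0 hm hm' hM hdisc ha hb1
  by_cases hfar : 2 * m + 2 ≤ b
  · left
    intro i
    obtain ⟨x, y, hxy, hi⟩ := hdisc i
    exact ⟨x, y, separates_of_disjoint hm0 hm' hM hfar hxy, hi⟩
  by_cases hsteep : 6 ≤ b ∧ 4 * |c| ≤ b
  · left
    exact hitsLines_of_steep hm hM hdisc hsteep.1 (by linarith [le_abs_self c])
      (by linarith [neg_abs_le c])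
  right
  intro i
  obtain ⟨x, y, hxy, hi⟩ := exists_separates_row_modEq hNM hm hm' hb
    (Int.one_le_abs hc0) hb1 (by lia) hsteep i
  rcases abs_cases c with ⟨h, -⟩ | ⟨h, -⟩
  · exact ⟨x, y, h ▸ hxy, hi⟩
  · refine ⟨-x, y, ?_, hi⟩
    rw [h] at hxy
    have e : (-x - -c) ^ 2 = (x - - -c) ^ 2 := by ring
    simpa only [Separates, e, neg_sq] using hxy

end Hits

theorem isIdCode_Ld_union_Lh {r Δ : ℝ} {s t : ℕ} (hr : 0 < r) (hΔ : 0 ≤ Δ) (hs : 0 < s)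
    (hsd : s ≤ diagNum (ball r ((0, 0) : ℤ × ℤ)))
    (ha : IntersectsDiagMod (Spat r Δ ((0, 0) : ℤ × ℤ) ((-1, 0) : ℤ × ℤ)) s)
    (hb : IntersectsHorizMod (Spat r Δ ((0, 0) : ℤ × ℤ) ((-1, -1) : ℤ × ℤ)) t)
    (hc1 : Real.sqrt ((⌊r⌋ : ℝ) ^ 2 + 4) ≤ r) :
    IsIdCode r Δ (Ld s ∪ Lh t) := by
  have hdisc := exists_mem_disc_modEq hs hsd
  have hm0 : 0 ≤ ⌊r⌋ := Int.floor_nonneg.mpr hr.le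
  have hm : ⌊r⌋ ^ 2 + 4 ≤ ⌊r ^ 2⌋ := by
    rw [Int.le_floor]
    push_cast
    exact (Real.sqrt_le_left hr.le).mp hc1
  have hm' : ⌊r ^ 2⌋ < (⌊r⌋ + 1) ^ 2 := by
    rw [Int.floor_lt]
    push_cast
    have := Int.lt_floor_add_one r
    gcongr
  have hNM : ⌊r ^ 2⌋ ≤ ⌊(r + Δ) ^ 2⌋ := by
    apply Int.floor_le_floor
    gcongr
    linarith
  have ha' : ∀ i : ℤ, ∃ x y : ℤ, Separates ⌊r ^ 2⌋ ⌊(r + Δ) ^ 2⌋ (-1) 0 x y ∧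
      y - x ≡ i [ZMOD s] := fun i => by
    obtain ⟨p, hp, hi⟩ := ha i
    rw [mem_Spat_iff_separates] at hp
    exact ⟨p.1, p.2, by simpa using hp, hi⟩
  have hb' : ∀ i : ℤ, ∃ x y : ℤ, Separates ⌊r ^ 2⌋ ⌊(r + Δ) ^ 2⌋ (-1) (-1) x y ∧
      y ≡ i [ZMOD t] := fun i => by
    obtain ⟨p, hp, hi⟩ := hb i
    rw [mem_Spat_iff_separates] at hp
    exact ⟨p.1, p.2, by simpa using hp, hi⟩
  have hM : ⌊(r + Δ) ^ 2⌋ ≤ ⌊r ^ 2⌋ + 2 * ⌊r⌋ := by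
    obtain ⟨x, y, h, -⟩ := ha' 0
    rcases h with ⟨h1, h2⟩ | ⟨h1, h2⟩
    · have : x ≤ ⌊r⌋ := by nlinarith [sq_nonneg y]
      nlinarith
    · have : -⌊r⌋ ≤ x + 1 := by nlinarith [sq_nonneg y]
      nlinarith
  have main : ∀ u v : ℤ × ℤ, v.2 < u.2 ∨ (v.2 = u.2 ∧ v.1 < u.1) →
      (Spat r Δ u v ∩ (Ld s ∪ Lh t)).Nonempty := by
    rintro u v (huv | ⟨huv, huv'⟩)
    · apply HitsLines.nonempty
      have := hitsLines_neg (c := u.1 - v.1) (b := u.2 - v.2) hNM hm0 hm hm' hM hdisc ha' hb'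
        (by lia)
      simpa using this
    · apply HitsLines.nonempty
      left
      have := hitsLines_horizontal (a := u.1 - v.1) hNM hm0 hm hm' hM hdisc ha' (by lia)
      simpa [huv] using this
  refine ⟨fun u => ?_, fun u v huv => ?_⟩
  · obtain ⟨x, y, hxy, hi⟩ := hdisc (-(u.2 - u.1))
    refine ⟨(u.1 + x, u.2 + y), ?_, Or.inl ?_⟩
    · rw [mem_ball_iff_floor]
      simpa using hxy
    · have := hi.symm.dvd
      simp only [Ld, Set.mem_ofPred_eq]
      convert this using 1
      ring
  · rcases lt_trichotomy v.2 u.2 with h | h | h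
    · exact main u v (Or.inl h)
    · rcases lt_trichotomy v.1 u.1 with h1 | h1 | h1
      · exact main u v (Or.inr ⟨h, h1⟩)
      · exact absurd (Prod.ext h1.symm h.symm) huv
      · rw [Spat_comm]
        exact main v u (Or.inr ⟨h.symm, h1⟩)
    · rw [Spat_comm]
      exact main v u (Or.inl h)

/-- The number of integers of a residue class in a symmetric interval of length `2 n + 1`. -/
theorem abs_card_filter_modEq_sub_le {k : ℕ} (hk : 0 < k) (n : ℕ) (v : ℤ) :
    |(((Finset.Icc (-(n : ℤ)) n).filter (fun x => x ≡ v [ZMOD k])).card : ℝ) -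
      (2 * (n : ℝ) + 1) / k| ≤ 1 := by
  have hI : Finset.Icc (-(n : ℤ)) n = Finset.Ioc (-(n : ℤ) - 1) n := by
    ext
    simp only [Finset.mem_Icc, Finset.mem_Ioc]
    lia
  have hk' : (0 : ℤ) < k := by exact_mod_cast hk
  have hcard := Int.Ioc_filter_modEq_card (-(n : ℤ) - 1) n hk' v
  set A := ⌊((n : ℤ) - v : ℚ) / (k : ℤ)⌋ with hA
  set B := ⌊((-(n : ℤ) - 1 : ℤ) - v : ℚ) / (k : ℤ)⌋ with hB
  have hAB : B ≤ A := by
    apply Int.floor_le_floor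
    have : (0 : ℚ) < (k : ℤ) := by exact_mod_cast hk
    gcongr
    have : (0 : ℚ) ≤ n := by positivity
    linarith
  rw [max_eq_left (by lia)] at hcard
  rw [hI]
  have hcard' : ((((Finset.Ioc (-(n : ℤ) - 1) n).filter (fun x => x ≡ v [ZMOD k])).card : ℚ)) =
      A - B := by exact_mod_cast hcard
  have key : |((((Finset.Ioc (-(n : ℤ) - 1) n).filter (fun x => x ≡ v [ZMOD k])).card : ℚ)) -
      (2 * (n : ℚ) + 1) / k| ≤ 1 := by
    rw [hcard']
    have e : (2 * (n : ℚ) + 1) / k = ((n : ℤ) - v : ℚ) / (k : ℤ) -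
        ((-(n : ℤ) - 1 : ℤ) - v : ℚ) / (k : ℤ) := by
      push_cast
      ring
    rw [e, abs_le]
    have a1 := Int.floor_le (((n : ℤ) - v : ℚ) / (k : ℤ))
    have a2 := Int.lt_floor_add_one (((n : ℤ) - v : ℚ) / (k : ℤ))
    have b1 := Int.floor_le (((-(n : ℤ) - 1 : ℤ) - v : ℚ) / (k : ℤ))
    have b2 := Int.lt_floor_add_one (((-(n : ℤ) - 1 : ℤ) - v : ℚ) / (k : ℤ))
    rw [← hA] at a1 a2
    rw [← hB] at b1 b2
    constructor <;> linarith
  have keyR := (Rat.cast_le (K := ℝ)).mpr key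
  push_cast at keyR
  exact keyR

open scoped Classical in
theorem card_inter_Qset (C : Set (ℤ × ℤ)) (n : ℕ) :
    (Nat.card ↥(C ∩ Qset n) : ℝ) = ∑ y ∈ Finset.Icc (-(n : ℤ)) n,
      (((Finset.Icc (-(n : ℤ)) n).filter (fun x => (x, y) ∈ C)).card : ℝ) := by
  have h : C ∩ Qset n = ↑((Finset.Icc (-(n : ℤ)) n ×ˢ Finset.Icc (-(n : ℤ)) n).filter
      (fun p => p ∈ C)) := by
    ext p
    simp only [Qset, Set.mem_inter_iff, Set.mem_ofPred_eq, Finset.coe_filter, Finset.mem_product,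
      Finset.mem_Icc, abs_le]
    tauto
  rw [h, Nat.card_coe_set_eq, Set.ncard_coe_finset, Finset.card_filter, Finset.sum_product_right]
  push_cast [Finset.card_filter]
  rfl

open scoped Classical in
theorem abs_card_Ld_union_Lh_sub_le {s t : ℕ} (hs : 0 < s) (ht : 0 < t) (n : ℕ) :
    |(Nat.card ↥((Ld s ∪ Lh t) ∩ Qset n) : ℝ) -
      (1 / (s : ℝ) + 1 / (t : ℝ) - 1 / ((s : ℝ) * (t : ℝ))) * (2 * (n : ℝ) + 1) ^ 2| ≤
      2 * (2 * (n : ℝ) + 1) := by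
  obtain ⟨C, hC⟩ : ∃ C, C = Ld s ∪ Lh t := ⟨_, rfl⟩
  rw [← hC]
  rw [card_inter_Qset]
  set I := Finset.Icc (-(n : ℤ)) n with hI
  set L : ℝ := 2 * (n : ℝ) + 1 with hL
  have hL0 : 0 ≤ L := by positivity
  have hIcard : (I.card : ℝ) = L := by
    have : I.card = 2 * n + 1 := by simp [hI]; lia
    rw [this, hL]
    push_cast
    ring
  have hrow : ∀ y ∈ I, |((I.filter (fun x => (x, y) ∈ C)).card : ℝ) -
      (if y ≡ 0 [ZMOD t] then L else L / s)| ≤ 1 := by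
    intro y _
    split_ifs with hy
    · have : I.filter (fun x => (x, y) ∈ C) = I := by
        apply Finset.filter_true_of_mem
        intro x _
        exact hC ▸ Or.inr (Int.modEq_zero_iff_dvd.mp hy)
      rw [this, hIcard]
      simp
    · have : I.filter (fun x => (x, y) ∈ C) = I.filter (fun x => x ≡ y [ZMOD s]) := by
        apply Finset.filter_congr
        intro x _
        have hy' : ¬ (t : ℤ) ∣ y := fun h => hy (Int.modEq_zero_iff_dvd.mpr h)
        simp [hC, Ld, Lh, hy', Int.modEq_iff_dvd]
      rw [this]
      exact abs_card_filter_modEq_sub_le hs n y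
  have hsum := Finset.sum_le_sum hrow
  have habs := Finset.abs_sum_le_sum_abs
    (fun y => ((I.filter (fun x => (x, y) ∈ C)).card : ℝ) -
      (if y ≡ 0 [ZMOD t] then L else L / s)) I
  have htri := habs.trans hsum
  rw [Finset.sum_sub_distrib, Finset.sum_const, nsmul_eq_mul, mul_one, hIcard] at htri
  set R : ℝ := ((I.filter (fun y => y ≡ 0 [ZMOD t])).card : ℝ) with hR
  have hRL : |R - L / t| ≤ 1 := abs_card_filter_modEq_sub_le ht n 0
  have hmain : ∑ y ∈ I, (if y ≡ 0 [ZMOD t] then L else L / s) = R * (L - L / s) + L * (L / s) := by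
    have : ∀ y : ℤ, (if y ≡ 0 [ZMOD t] then L else L / s) =
        (if y ≡ 0 [ZMOD t] then 1 else 0) * (L - L / s) + L / s := fun y => by
      split_ifs <;> ring
    simp only [this]
    rw [Finset.sum_add_distrib, ← Finset.sum_mul, Finset.sum_boole, Finset.sum_const,
      nsmul_eq_mul, hIcard]
  rw [hmain] at htri
  have hs1 : (1 : ℝ) ≤ s := by exact_mod_cast hs
  have ht1 : (1 : ℝ) ≤ t := by exact_mod_cast ht
  have hLs : |L - L / s| ≤ L := by
    have h1 : L / s ≤ L := div_le_self hL0 hs1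
    have h2 : 0 ≤ L / s := by positivity
    rw [abs_le]
    constructor <;> linarith
  have hprod : |(R - L / t) * (L - L / s)| ≤ L := by
    rw [abs_mul]
    calc _ ≤ 1 * L := by gcongr
      _ = L := one_mul L
  have hadd := (abs_add_le _ _).trans (add_le_add htri hprod)
  have e : ∀ A : ℝ, A - (1 / (s : ℝ) + 1 / (t : ℝ) - 1 / ((s : ℝ) * (t : ℝ))) * L ^ 2 =
      A - (R * (L - L / s) + L * (L / s)) + (R - L / t) * (L - L / s) := fun A => by ring
  rw [e, two_mul]
  exact hadd

theorem density_Ld_union_Lh {s t : ℕ} (hs : 0 < s) (ht : 0 < t) :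
    density (Ld s ∪ Lh t) = 1 / (s : ℝ) + 1 / (t : ℝ) - 1 / ((s : ℝ) * (t : ℝ)) := by
  apply Tendsto.limsup_eq
  have hlim : Tendsto (fun n : ℕ => 2 / (2 * (n : ℝ) + 1)) atTop (nhds 0) := by
    apply Tendsto.const_div_atTop
    exact tendsto_atTop_add_const_right _ _
      (tendsto_natCast_atTop_atTop.const_mul_atTop two_pos)
  rw [tendsto_iff_dist_tendsto_zero]
  refine squeeze_zero (fun _ => dist_nonneg) (fun n => ?_) hlim
  have hL : (0 : ℝ) < 2 * (n : ℝ) + 1 := by positivity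
  have h := abs_card_Ld_union_Lh_sub_le hs ht n
  rw [Real.dist_eq, div_sub' (by positivity), abs_div, abs_of_pos (by positivity : (0 : ℝ) <
    (2 * (n : ℝ) + 1) ^ 2), div_le_div_iff₀ (by positivity) hL]
  rw [mul_comm ((2 * (n : ℝ) + 1) ^ 2)]
  nlinarith

theorem stmt7 (r Δ : ℝ) (hr : 0 < r) (hΔ : 0 ≤ Δ) (s t : ℕ) (hs : 0 < s) (ht : 0 < t)
    (hsd : s ≤ diagNum (ball r ((0, 0) : ℤ × ℤ)))
    (ha : IntersectsDiagMod (Spat r Δ ((0, 0) : ℤ × ℤ) ((-1, 0) : ℤ × ℤ)) s)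
    (hb : IntersectsHorizMod (Spat r Δ ((0, 0) : ℤ × ℤ) ((-1, -1) : ℤ × ℤ)) t)
    (hc1 : Real.sqrt ((⌊r⌋ : ℝ) ^ 2 + 4) ≤ r) (hc2 : r < (⌊r⌋ : ℝ) + 1) :
    IsIdCode r Δ (Ld s ∪ Lh t) ∧
      density (Ld s ∪ Lh t) = 1 / (s : ℝ) + 1 / (t : ℝ) - 1 / ((s : ℝ) * (t : ℝ)) :=
  ⟨isIdCode_Ld_union_Lh hr hΔ hs hsd ha hb hc1, density_Ld_union_Lh hs ht⟩
end

section
/- Let s be a fixed positive integer. There exists a real number r₀ such that for all real r ≥ r₀ and all real Δ with 0 ≤ Δ ≤ 1: if S_{r,Δ}((0,0),(−1,0)) intersects all diagonal lines modulo s, then the set L^d_s = {(x,y) ∈ ℤ² : y−x ≡ 0 (mod s)} is an (r,Δ)-identifying code of density 1/s; in particular there exists an (r,Δ)-identifying code C with D(C) = 1/s. -/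
open Filter

/-- A single inequality, checked along a lattice direction `(p, q)`, gives points in every
diagonal class that lie in the ball around `(a, b)` and outside the enlarged ball around `0`. -/
theorem eventually_exists_of_direction {s : ℕ} (hs : 0 < s) {a b p q : ℤ}
    (hpq : IsCoprime p q) (hsum : IsCoprime (p + q) (s : ℤ))
    (h : √((p : ℝ) ^ 2 + (q : ℝ) ^ 2) + 1 < p * a + q * b) :
    ∀ᶠ r : ℝ in atTop, ∀ i : ℤ, ∃ x y : ℤ, Int.ModEq (s : ℤ) (y - x) i ∧
      ((x : ℝ) - a) ^ 2 + ((y : ℝ) - b) ^ 2 ≤ r ^ 2 ∧ (r + 1) ^ 2 < (x : ℝ) ^ 2 + (y : ℝ) ^ 2 := by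
  obtain ⟨u, v, huv⟩ := hpq
  obtain ⟨k, l, hkl⟩ := hsum
  have hN : 0 < p ^ 2 + q ^ 2 := by
    by_contra! hle
    have hp : p = 0 := by nlinarith [sq_nonneg p, sq_nonneg q]
    have hq : q = 0 := by nlinarith [sq_nonneg p, sq_nonneg q]
    simp [hp, hq] at huv
  have hNR : (1 : ℝ) ≤ (p : ℝ) ^ 2 + (q : ℝ) ^ 2 := by exact_mod_cast hN
  set n : ℝ := √((p : ℝ) ^ 2 + (q : ℝ) ^ 2) with hn
  have hn2 : n ^ 2 = (p : ℝ) ^ 2 + (q : ℝ) ^ 2 := Real.sq_sqrt (by positivity)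
  have hn1 : 1 ≤ n := by rw [hn]; exact Real.one_le_sqrt.mpr hNR
  set W : ℝ := (p : ℝ) * a + q * b with hW
  set δ : ℝ := W - n - 1 with hδ
  have hδ0 : 0 < δ := by linarith
  set K : ℝ := (q : ℝ) * a - p * b with hK
  set M : ℝ := (s * n ^ 2 + |K|) ^ 2 with hM
  filter_upwards [eventually_ge_atTop (0 : ℝ), eventually_ge_atTop W,
    eventually_ge_atTop ((δ ^ 2 + M) / (2 * δ))] with r hr0 hrW hrM i
  rw [div_le_iff₀ (by positivity)] at hrM
  set c : ℤ := ⌊n * (r + 1)⌋ + 1 with hc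
  have hc1 : n * (r + 1) < c := by rw [hc]; push_cast; exact Int.lt_floor_add_one _
  have hc2 : (c : ℝ) ≤ n * (r + 1) + 1 := by
    rw [hc]; push_cast; linarith [Int.floor_le (n * (r + 1))]
  set t₀ : ℤ := (c * (v - u) - i) * k with ht₀
  set m : ℤ := s * (p ^ 2 + q ^ 2) with hm
  have hm0 : 0 < m := by positivity
  set d₀ : ℤ := c * (q * u - p * v) + t₀ * (p ^ 2 + q ^ 2) with hd₀
  set t : ℤ := t₀ - s * (d₀ / m) with ht
  set x : ℤ := c * u + t * q with hx
  set y : ℤ := c * v - t * p with hy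
  have hcxy : p * x + q * y = c := by rw [hx, hy]; linear_combination c * huv
  have hd : q * x - p * y = d₀ % m := by
    rw [Int.emod_def, hx, hy, ht, hm, hd₀]; ring
  have hd1 : 0 ≤ q * x - p * y := hd ▸ Int.emod_nonneg _ hm0.ne'
  have hd2 : q * x - p * y ≤ m := hd ▸ (Int.emod_lt_of_pos _ hm0).le
  have hcR : (p : ℝ) * x + q * y = c := by exact_mod_cast hcxy
  have hd1R : (0 : ℝ) ≤ q * x - p * y := by exact_mod_cast hd1
  have hd2R : (q : ℝ) * x - p * y ≤ s * n ^ 2 := by rw [hn2]; exact_mod_cast hd2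
  refine ⟨x, y, ?_, ?_, ?_⟩
  · refine Int.modEq_iff_dvd.2 ⟨-(c * (v - u) - i) * l - d₀ / m * (p + q), ?_⟩
    rw [hy, hx, ht, ht₀]
    linear_combination (c * (v - u) - i) * hkl
  · have hdist : n ^ 2 * (((x : ℝ) - a) ^ 2 + ((y : ℝ) - b) ^ 2) =
        (c - W) ^ 2 + ((q * x - p * y) - K) ^ 2 := by
      rw [hn2, ← hcR, hW, hK]; ring
    have hKM : ((q * x - p * y : ℝ) - K) ^ 2 ≤ M := by
      apply sq_le_sq'
      · linarith [le_abs_self K, mul_nonneg (Nat.cast_nonneg (α := ℝ) s) (sq_nonneg n)]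
      · linarith [neg_abs_le K]
    have hcW : (c - W) ^ 2 ≤ (n * r - δ) ^ 2 := by
      apply pow_le_pow_left₀
      · nlinarith
      · linarith
    have : n ^ 2 * (((x : ℝ) - a) ^ 2 + ((y : ℝ) - b) ^ 2) ≤ n ^ 2 * r ^ 2 := by
      have : r * (2 * δ) ≤ n * (r * (2 * δ)) := le_mul_of_one_le_left (by positivity) hn1
      nlinarith
    exact le_of_mul_le_mul_left this (by positivity)
  · have hdist : n ^ 2 * ((x : ℝ) ^ 2 + (y : ℝ) ^ 2) = c ^ 2 + (q * x - p * y : ℝ) ^ 2 := by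
      rw [hn2, ← hcR]; ring
    have hlt : (n * (r + 1)) ^ 2 < (c : ℝ) ^ 2 := pow_lt_pow_left₀ hc1 (by positivity) two_ne_zero
    have : n ^ 2 * (r + 1) ^ 2 < n ^ 2 * ((x : ℝ) ^ 2 + (y : ℝ) ^ 2) := by
      nlinarith [sq_nonneg (q * x - p * y : ℝ)]
    exact lt_of_mul_lt_mul_left this (by positivity)

/-- Away from `0` and its four neighbours, a displacement admits a lattice direction along which
it exceeds the bound required by `eventually_exists_of_direction`. -/
theorem exists_direction {s : ℕ} (hs : 0 < s) {a b : ℤ} (h : 1 < a ^ 2 + b ^ 2) :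
    ∃ p q : ℤ, IsCoprime p q ∧ IsCoprime (p + q) (s : ℤ) ∧
      √((p : ℝ) ^ 2 + (q : ℝ) ^ 2) + 1 < p * a + q * b := by
  wlog hab : |a| ≤ |b| generalizing a b
  · obtain ⟨p, q, h1, h2, h3⟩ := this (by linarith) (le_of_not_ge hab)
    refine ⟨q, p, h1.symm, add_comm p q ▸ h2, ?_⟩
    rwa [add_comm ((q : ℝ) ^ 2), add_comm ((q : ℝ) * a)]
  wlog hb : 0 ≤ b generalizing a b
  · obtain ⟨p, q, h1, h2, h3⟩ := this (a := -a) (b := -b) (by linarith [neg_sq a, neg_sq b])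
      (by simpa using hab) (by omega)
    refine ⟨-p, -q, h1.neg_neg, neg_add p q ▸ h2.neg_left, ?_⟩
    push_cast at h3 ⊢
    simpa using h3
  rw [abs_of_nonneg hb] at hab
  obtain ⟨hab1, hab2⟩ := abs_le.1 hab
  have hs1 : (1 : ℝ) ≤ s := by exact_mod_cast hs
  have key : ∀ p q : ℤ, 0 ≤ (p : ℝ) * a + q * b - 1 →
      (p : ℝ) ^ 2 + (q : ℝ) ^ 2 < (p * a + q * b - 1) ^ 2 →
      √((p : ℝ) ^ 2 + (q : ℝ) ^ 2) + 1 < p * a + q * b := fun p q h0 h1 => by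
    linarith [(Real.sqrt_lt' (lt_of_le_of_ne h0 (by rintro h; rw [← h] at h1; nlinarith))).2 h1]
  rcases le_or_gt 2 b with hb2 | hb2
  · refine ⟨1, 6 * s, isCoprime_one_left, ⟨1, -6, by ring⟩, ?_⟩
    have hb2R : (2 : ℝ) ≤ b := by exact_mod_cast hb2
    have haR : -(b : ℝ) ≤ a := by exact_mod_cast hab1
    have : 12 * (s : ℝ) - 3 ≤ 1 * a + 6 * s * b - 1 := by nlinarith
    apply key
    · push_cast; linarith
    · push_cast; nlinarith
  · have hb1 : b = 1 := by
      rcases (by omega : b = 0 ∨ b = 1) with rfl | rfl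
      · obtain rfl : a = 0 := by omega
        simp at h
      · rfl
    subst hb1
    rcases (by omega : a = -1 ∨ a = 0 ∨ a = 1) with rfl | rfl | rfl
    · refine ⟨-2, 3, ⟨1, 1, by norm_num⟩, by norm_num [isCoprime_one_left], ?_⟩
      apply key <;> norm_num
    · simp at h
    · refine ⟨6 * s, 6 * s + 1, ⟨-1, 1, by ring⟩, ⟨1, -12, by ring⟩, ?_⟩
      apply key
      · push_cast; linarith
      · push_cast; nlinarith

theorem exists_modEq_near {s : ℕ} (hs : 0 < s) (X Y : ℝ) (i : ℤ) :
    ∃ x y : ℤ, Int.ModEq (s : ℤ) (y - x) i ∧ |(x : ℝ) - X| ≤ s + 1 ∧ |(y : ℝ) - Y| ≤ 1 := by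
  have hs' : (0 : ℤ) < s := by exact_mod_cast hs
  set j : ℤ := (⌊Y⌋ - ⌊X⌋ - i) % s with hj
  have hj0 : (0 : ℝ) ≤ j := by exact_mod_cast Int.emod_nonneg _ hs'.ne'
  have hj1 : (j : ℝ) ≤ s := by exact_mod_cast (Int.emod_lt_of_pos _ hs').le
  refine ⟨⌊X⌋ + j, ⌊Y⌋, ?_, ?_, ?_⟩
  · rw [Int.modEq_iff_dvd, hj, Int.emod_def]
    exact ⟨-((⌊Y⌋ - ⌊X⌋ - i) / s), by ring⟩
  · push_cast
    rw [abs_le]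
    constructor <;> linarith [Int.floor_le X, Int.lt_floor_add_one X]
  · rw [abs_le]
    constructor <;> linarith [Int.floor_le Y, Int.lt_floor_add_one Y]

theorem exists_of_far {s : ℕ} (hs : 0 < s) {r : ℝ} (hr : (s : ℝ) + 2 ≤ r) {a b : ℤ}
    (h : (2 * s + 5 : ℝ) ^ 2 < (a : ℝ) ^ 2 + (b : ℝ) ^ 2) (i : ℤ) :
    ∃ x y : ℤ, Int.ModEq (s : ℤ) (y - x) i ∧
      ((x : ℝ) - a) ^ 2 + ((y : ℝ) - b) ^ 2 ≤ r ^ 2 ∧ (r + 1) ^ 2 < (x : ℝ) ^ 2 + (y : ℝ) ^ 2 := by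
  have norm_sq : ∀ x y : ℝ, ‖(⟨x, y⟩ : ℂ)‖ ^ 2 = x ^ 2 + y ^ 2 := fun x y => by
    rw [Complex.sq_norm, Complex.normSq_mk]; ring
  set w : ℂ := ⟨a, b⟩ with hw
  have hW : 2 * s + 5 < ‖w‖ := by
    rw [← norm_sq] at h
    exact lt_of_pow_lt_pow_left₀ 2 (norm_nonneg _) h
  have hW0 : 0 < ‖w‖ := by linarith [Nat.cast_nonneg (α := ℝ) s]
  set l : ℝ := (r - (s + 2)) / ‖w‖ with hl
  have hl0 : 0 ≤ l := div_nonneg (by linarith) hW0.le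
  have hlW : l * ‖w‖ = r - (s + 2) := div_mul_cancel₀ _ hW0.ne'
  obtain ⟨x, y, hxy, hx, hy⟩ := exists_modEq_near hs ((1 + l) * a) ((1 + l) * b) i
  set z : ℂ := ⟨x, y⟩ with hz
  have hzg : ‖z - ((1 + l : ℝ) : ℂ) * w‖ ≤ s + 2 := by
    refine (Complex.norm_le_abs_re_add_abs_im _).trans ?_
    simp only [hz, hw, Complex.sub_re, Complex.sub_im, Complex.re_ofReal_mul,
      Complex.im_ofReal_mul]
    linarith
  refine ⟨x, y, hxy, ?_, ?_⟩
  · have hzw : ‖z - w‖ ≤ r := by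
      have : z - w = (z - ((1 + l : ℝ) : ℂ) * w) + (l : ℂ) * w := by push_cast; ring
      rw [this]
      refine (norm_add_le _ _).trans ?_
      rw [norm_mul, Complex.norm_of_nonneg hl0]
      linarith
    rw [← norm_sq]
    exact pow_le_pow_left₀ (norm_nonneg _) hzw 2
  · have hzr : r + 1 < ‖z‖ := by
      have := norm_sub_norm_le (((1 + l : ℝ) : ℂ) * w) z
      rw [norm_mul, Complex.norm_of_nonneg (by linarith), norm_sub_rev] at this
      linarith
    rw [← norm_sq]
    exact pow_lt_pow_left₀ hzr (by linarith [Nat.cast_nonneg (α := ℝ) s]) two_ne_zero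

theorem mem_Spat {r Δ : ℝ} {u v p : ℤ × ℤ} :
    p ∈ Spat r Δ u v ↔
      ((p.1 - u.1 : ℝ) ^ 2 + (p.2 - u.2 : ℝ) ^ 2 ≤ r ^ 2 ∧
        (r + Δ) ^ 2 < (p.1 - v.1 : ℝ) ^ 2 + (p.2 - v.2 : ℝ) ^ 2) ∨
      ((p.1 - v.1 : ℝ) ^ 2 + (p.2 - v.2 : ℝ) ^ 2 ≤ r ^ 2 ∧
        (r + Δ) ^ 2 < (p.1 - u.1 : ℝ) ^ 2 + (p.2 - u.2 : ℝ) ^ 2) := by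
  simp [Spat, ball]

theorem add_mem_Spat_add_iff {r Δ : ℝ} {u v p c : ℤ × ℤ} :
    p + c ∈ Spat r Δ (u + c) (v + c) ↔ p ∈ Spat r Δ u v := by
  simp [mem_Spat]

theorem swap_mem_Spat_swap_iff {r Δ : ℝ} {u v p : ℤ × ℤ} :
    p.swap ∈ Spat r Δ u.swap v.swap ↔ p ∈ Spat r Δ u v := by
  simp [mem_Spat, add_comm]

theorem IntersectsDiagMod.Spat_add {r Δ : ℝ} {u v : ℤ × ℤ} {s : ℕ}
    (h : IntersectsDiagMod (Spat r Δ u v) s) (c : ℤ × ℤ) :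
    IntersectsDiagMod (Spat r Δ (u + c) (v + c)) s := fun i => by
  obtain ⟨p, hp, hi⟩ := h (i - (c.2 - c.1))
  refine ⟨p + c, add_mem_Spat_add_iff.2 hp, ?_⟩
  have := hi.add_right (c.2 - c.1)
  rw [sub_add_cancel] at this
  convert this using 1
  simp only [Prod.fst_add, Prod.snd_add]
  ring

theorem IntersectsDiagMod.Spat_swap {r Δ : ℝ} {u v : ℤ × ℤ} {s : ℕ}
    (h : IntersectsDiagMod (Spat r Δ u v) s) :
    IntersectsDiagMod (Spat r Δ u.swap v.swap) s := fun i => by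
  obtain ⟨p, hp, hi⟩ := h (-i)
  refine ⟨p.swap, swap_mem_Spat_swap_iff.2 hp, ?_⟩
  simpa using hi.neg

theorem intersectsDiagMod_Spat_of_unit {r Δ : ℝ} {s : ℕ}
    (h : IntersectsDiagMod (Spat r Δ (0, 0) (-1, 0)) s) {a b : ℤ} (hab : a ^ 2 + b ^ 2 = 1) :
    IntersectsDiagMod (Spat r Δ (0, 0) (a, b)) s := by
  have h' : IntersectsDiagMod (Spat r Δ (0, 0) (1, 0)) s := by
    simpa [Spat_comm r Δ (1, 0)] using h.Spat_add (1, 0)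
  have ha : a ∈ Set.Icc (-1 : ℤ) 1 := ⟨by nlinarith [sq_nonneg b], by nlinarith [sq_nonneg b]⟩
  have hb : b ∈ Set.Icc (-1 : ℤ) 1 := ⟨by nlinarith [sq_nonneg a], by nlinarith [sq_nonneg a]⟩
  obtain ⟨ha1, ha2⟩ := ha
  obtain ⟨hb1, hb2⟩ := hb
  interval_cases a <;> interval_cases b <;> first
    | exact h
    | exact h'
    | exact h.Spat_swap
    | exact h'.Spat_swap
    | norm_num at hab

theorem eventually_exists_of_one_lt {s : ℕ} (hs : 0 < s) :
    ∀ᶠ r : ℝ in atTop, ∀ a b : ℤ, 1 < a ^ 2 + b ^ 2 → ∀ i : ℤ, ∃ x y : ℤ,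
      Int.ModEq (s : ℤ) (y - x) i ∧
      ((x : ℝ) - a) ^ 2 + ((y : ℝ) - b) ^ 2 ≤ r ^ 2 ∧ (r + 1) ^ 2 < (x : ℝ) ^ 2 + (y : ℝ) ^ 2 := by
  set N : ℤ := 2 * s + 5 with hN
  have hN0 : 0 ≤ N := by positivity
  have hfin := Set.finite_Icc ((-N, -N) : ℤ × ℤ) (N, N)
  have hnear : ∀ᶠ r : ℝ in atTop, ∀ w ∈ Set.Icc ((-N, -N) : ℤ × ℤ) (N, N),
      1 < w.1 ^ 2 + w.2 ^ 2 → ∀ i : ℤ, ∃ x y : ℤ, Int.ModEq (s : ℤ) (y - x) i ∧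
        ((x : ℝ) - w.1) ^ 2 + ((y : ℝ) - w.2) ^ 2 ≤ r ^ 2 ∧
        (r + 1) ^ 2 < (x : ℝ) ^ 2 + (y : ℝ) ^ 2 := by
    rw [eventually_all_finite hfin]
    intro w _
    by_cases hw : 1 < w.1 ^ 2 + w.2 ^ 2
    · obtain ⟨p, q, h1, h2, h3⟩ := exists_direction hs hw
      exact (eventually_exists_of_direction hs h1 h2 h3).mono fun r hr _ => hr
    · exact Eventually.of_forall fun r h => absurd h hw
  filter_upwards [hnear, eventually_ge_atTop ((s : ℝ) + 2)] with r hr hrs a b hab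
  by_cases hle : a ^ 2 + b ^ 2 ≤ N ^ 2
  · obtain ⟨ha1, ha2⟩ := abs_le.1 (abs_le_of_sq_le_sq (a := a) (b := N) (by nlinarith [sq_nonneg b]) hN0)
    obtain ⟨hb1, hb2⟩ := abs_le.1 (abs_le_of_sq_le_sq (a := b) (b := N) (by nlinarith [sq_nonneg a]) hN0)
    exact hr (a, b) ⟨⟨ha1, hb1⟩, ⟨ha2, hb2⟩⟩ hab
  · exact exists_of_far hs hrs (by rw [not_le, hN] at hle; exact_mod_cast hle)

theorem isIdCode_Ld {s : ℕ} (hs : 0 < s) {r Δ : ℝ} (hr : (s : ℝ) + 2 ≤ r)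
    (h : ∀ w : ℤ × ℤ, w ≠ 0 → IntersectsDiagMod (Spat r Δ (0, 0) w) s) :
    IsIdCode r Δ (Ld s) := by
  refine ⟨fun u => ?_, fun u v huv => ?_⟩
  · obtain ⟨x, y, hxy, hx, hy⟩ := exists_modEq_near hs (u.1 : ℝ) (u.2 : ℝ) 0
    refine ⟨(x, y), ?_, Int.modEq_zero_iff_dvd.1 hxy⟩
    simp only [ball, Set.mem_ofPred_eq]
    push_cast
    have hx2 := sq_le_sq' (abs_le.1 hx).1 (abs_le.1 hx).2
    have hy2 := sq_le_sq' (abs_le.1 hy).1 (abs_le.1 hy).2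
    nlinarith [Nat.cast_nonneg (α := ℝ) s]
  · obtain ⟨p, hp, hi⟩ := (h (v - u) (sub_ne_zero.2 huv.symm)).Spat_add u 0
    rw [Prod.mk_zero_zero, zero_add, sub_add_cancel] at hp
    exact ⟨p, hp, Int.modEq_zero_iff_dvd.1 hi⟩

theorem card_Ld_inter_Qset (s n : ℕ) :
    Nat.card ↥(Ld s ∩ Qset n) =
      ∑ y ∈ Finset.Ioc (-n - 1 : ℤ) n, {x ∈ Finset.Ioc (-n - 1 : ℤ) n | x ≡ y [ZMOD s]}.card := by
  rw [← Finset.card_sigma, Nat.card_coe_set_eq, ← Set.ncard_coe_finset]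
  refine Set.ncard_congr (fun p _ => ⟨p.2, p.1⟩) ?_ ?_ ?_
  · rintro ⟨x, y⟩ ⟨hd, hx, hy⟩
    rw [abs_le] at hx hy
    simp only [Finset.coe_sigma, Set.mem_sigma_iff, Finset.coe_filter, Finset.mem_Ioc,
      Finset.mem_coe, Set.mem_ofPred_eq]
    exact ⟨by omega, by omega, Int.modEq_iff_dvd.2 hd⟩
  · rintro ⟨x, y⟩ ⟨x', y'⟩ _ _ h
    simp_all
  · rintro ⟨y, x⟩ h
    simp only [Finset.coe_sigma, Set.mem_sigma_iff, Finset.coe_filter, Finset.mem_Ioc,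
      Finset.mem_coe, Set.mem_ofPred_eq] at h
    exact ⟨(x, y), ⟨Int.modEq_iff_dvd.1 h.2.2, abs_le.2 ⟨by omega, by omega⟩,
      abs_le.2 ⟨by omega, by omega⟩⟩, rfl⟩

theorem abs_card_filter_modEq_sub_le_s9 {s : ℕ} (hs : 0 < s) (n : ℕ) (y : ℤ) :
    |(({x ∈ Finset.Ioc (-n - 1 : ℤ) n | x ≡ y [ZMOD s]}.card : ℕ) : ℝ) - (2 * n + 1) / s| ≤ 1 := by
  have hs' : (0 : ℤ) < s := by exact_mod_cast hs
  have hsQ : (0 : ℚ) < s := by exact_mod_cast hs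
  have hcard := Int.Ioc_filter_modEq_card (-n - 1 : ℤ) n hs' y
  rw [max_eq_left] at hcard
  · have hq : |(({x ∈ Finset.Ioc (-n - 1 : ℤ) n | x ≡ y [ZMOD s]}.card : ℤ) : ℚ)
        - (2 * n + 1) / s| ≤ 1 := by
      rw [hcard, abs_le]
      set A : ℚ := (((n : ℤ) : ℚ) - y) / ((s : ℤ) : ℚ) with hA
      set B : ℚ := (((-n - 1 : ℤ) : ℚ) - y) / ((s : ℤ) : ℚ) with hB
      have hAB : (2 * n + 1) / s = A - B := by rw [hA, hB]; push_cast; ring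
      rw [hAB]
      push_cast
      constructor <;>
        linarith [Int.floor_le A, Int.lt_floor_add_one A, Int.floor_le B, Int.lt_floor_add_one B]
    have hcast := (Rat.cast_le (K := ℝ)).2 hq
    push_cast at hcast
    exact hcast
  · refine sub_nonneg.2 (Int.floor_le_floor ?_)
    push_cast
    gcongr
    linarith [Nat.cast_nonneg (α := ℚ) n]

theorem density_Ld {s : ℕ} (hs : 0 < s) : density (Ld s) = 1 / (s : ℝ) := by
  refine Tendsto.limsup_eq (tendsto_iff_dist_tendsto_zero.2 ?_)
  refine squeeze_zero (fun _ => dist_nonneg) (fun n => ?_) tendsto_one_div_add_atTop_nhds_zero_nat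
  have hn : (0 : ℝ) < 2 * n + 1 := by positivity
  have hcard : |(Nat.card ↥(Ld s ∩ Qset n) : ℝ) - (2 * n + 1) * ((2 * n + 1) / s)| ≤ 2 * n + 1 := by
    have hI : ((Finset.Ioc (-n - 1 : ℤ) n).card : ℝ) = 2 * n + 1 := by
      have : ((Finset.Ioc (-n - 1 : ℤ) n).card : ℤ) = 2 * n + 1 := by
        rw [Int.card_Ioc]; omega
      exact_mod_cast this
    have hconst : (2 * n + 1) * ((2 * n + 1) / s) =
        ∑ _y ∈ Finset.Ioc (-n - 1 : ℤ) n, ((2 * n + 1) / s : ℝ) := by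
      rw [Finset.sum_const, nsmul_eq_mul, hI]
    rw [card_Ld_inter_Qset, hconst]
    push_cast
    rw [← Finset.sum_sub_distrib]
    refine (Finset.abs_sum_le_sum_abs _ _).trans ?_
    refine (Finset.sum_le_sum fun y _ => abs_card_filter_modEq_sub_le_s9 hs n y).trans ?_
    rw [Finset.sum_const, nsmul_eq_mul, hI, mul_one]
  have hs0 : (s : ℝ) ≠ 0 := by exact_mod_cast hs.ne'
  have heq : (Nat.card ↥(Ld s ∩ Qset n) : ℝ) / (2 * n + 1) ^ 2 - 1 / s =
      (Nat.card ↥(Ld s ∩ Qset n) - (2 * n + 1) * ((2 * n + 1) / s)) / (2 * n + 1) ^ 2 := by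
    field_simp
  rw [Real.dist_eq, heq, abs_div, abs_of_pos (pow_pos hn 2), div_le_div_iff₀ (by positivity)
    (by positivity)]
  nlinarith [Nat.cast_nonneg (α := ℝ) n]

theorem stmt9 (s : ℕ) (hs : 0 < s) :
    ∃ r₀ : ℝ, ∀ r : ℝ, r₀ ≤ r → ∀ Δ : ℝ, 0 ≤ Δ → Δ ≤ 1 →
      IntersectsDiagMod (Spat r Δ ((0, 0) : ℤ × ℤ) ((-1, 0) : ℤ × ℤ)) s →
      (IsIdCode r Δ (Ld s) ∧ density (Ld s) = 1 / (s : ℝ)) ∧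
        ∃ C : Set (ℤ × ℤ), IsIdCode r Δ C ∧ density C = 1 / (s : ℝ) := by
  have hev := (eventually_exists_of_one_lt hs).and (eventually_ge_atTop ((s : ℝ) + 2))
  obtain ⟨r₀, hr₀⟩ := eventually_atTop.1 hev
  refine ⟨r₀, fun r hr Δ hΔ0 hΔ1 h => ?_⟩
  obtain ⟨hlong, hrs⟩ := hr₀ r hr
  have hcode : IsIdCode r Δ (Ld s) := by
    refine isIdCode_Ld hs hrs fun ⟨a, b⟩ hw => ?_
    have hpos : 0 < a ^ 2 + b ^ 2 := by
      by_contra! hle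
      have ha : a = 0 := by nlinarith [sq_nonneg a, sq_nonneg b]
      have hb : b = 0 := by nlinarith [sq_nonneg a, sq_nonneg b]
      exact hw (by rw [ha, hb]; rfl)
    rcases (Int.add_one_le_iff.2 hpos).eq_or_lt with hunit | hlt
    · exact intersectsDiagMod_Spat_of_unit h (by simpa using hunit.symm)
    · intro i
      obtain ⟨x, y, hi, hin, hout⟩ := hlong a b (by simpa using hlt) i
      refine ⟨(x, y), mem_Spat.2 (Or.inr ⟨hin, ?_⟩), hi⟩
      have : (r + Δ) ^ 2 ≤ (r + 1) ^ 2 :=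
        pow_le_pow_left₀ (by linarith [Nat.cast_nonneg (α := ℝ) s]) (by linarith) 2
      simpa using this.trans_lt hout
  exact ⟨⟨hcode, density_Ld hs⟩, Ld s, hcode, density_Ld hs⟩
end
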